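/- An FSA S = (X, T, X_0, δ, Σ, ℓ) is not (O, T_f)-co-predictable if and only if in the concurrent composition CC_A(S^n; S_1^n, …, S_L^n) = (X', T', X_0', δ'), where S^n is the normal sub-automaton of S and each S_i^n is the normal sub-local automaton in location i, there is a transition sequence x_0' →^{s_1'} x_1' with x_0' ∈ X_0', x_1' ∈ X', s_1' ∈ (T')*, such that (x_1'(0), t_f, x) ∈ δ for some t_f ∈ T_f and x ∈ X, and for each i ∈ [1,L], in S_i^n there is a transition cycle reachable from x_1'(i). -/

import Mathlib

namespace DES

/-- Run of a labelled transition system along a finite word of events. -/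
inductive RunRel {S : Type*} {E : Type*} (δ : S → E → S → Prop) : S → List E → S → Prop
  | nil (x : S) : RunRel δ x [] x
  | cons {x y z : S} {e : E} {w : List E} :
      δ x e y → RunRel δ y w z → RunRel δ x (e :: w) z

/-- A labelling function (with `none` playing the role of the empty label ε)
extended to words by concatenation (ε's disappear). -/
def obsW {T : Type*} {Λ : Type*} (ℓ : T → Option Λ) (w : List T) : List Λ :=
  w.filterMap ℓ

/-- A finite-state automaton (FSA) `S = (X, T, X₀, δ, Σ, ℓ)`:
states `X`, events `T`, initial states `init`, transition relation `trans`,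
labels `Λ`, labelling function `lbl` (with `none` = ε, i.e. unobservable). -/
structure FSA (X : Type*) (T : Type*) (Λ : Type*) where
  init : Set X
  trans : Set (X × T × X)
  lbl : T → Option Λ

namespace FSA

variable {X : Type*} {T : Type*} {Λ : Type*}

def step (A : FSA X T Λ) (x : X) (t : T) (y : X) : Prop := (x, t, y) ∈ A.trans

/-- extension of the transition relation to words. -/
def Run (A : FSA X T Λ) : X → List T → X → Prop := RunRel A.step

/-- `L(S)`: finite event sequences generated from initial states. -/
def Lang (A : FSA X T Λ) : Set (List T) := {w | ∃ x0 ∈ A.init, ∃ x, A.Run x0 w x}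

def InfRun (A : FSA X T Λ) (x : ℕ → X) (s : ℕ → T) : Prop :=
  x 0 ∈ A.init ∧ ∀ n, A.step (x n) (s n) (x (n + 1))

/-- `L^ω(S)`: infinite event sequences generated from initial states. -/
def LangW (A : FSA X T Λ) : Set (ℕ → T) := {s | ∃ x, A.InfRun x s}

/-- current-state estimate `M_O(S, σ)` under the observation map `O`. -/
def est (A : FSA X T Λ) (O : T → Option Λ) (σ : List Λ) : Set X :=
  {x | ∃ x0 ∈ A.init, ∃ w : List T, obsW O w = σ ∧ A.Run x0 w x}

/-- `y` is reachable from `x` (by a nonempty word). -/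
def Reach (A : FSA X T Λ) (x y : X) : Prop := ∃ w : List T, w ≠ [] ∧ A.Run x w y

/-- `y` lies on a transition cycle. -/
def OnCycle (A : FSA X T Λ) (y : X) : Prop := ∃ w : List T, w ≠ [] ∧ A.Run y w y

/-- the normal sub-automaton: all faulty transitions removed. -/
def normal (A : FSA X T Λ) (Tf : Set T) : FSA X T Λ :=
  ⟨A.init, {tr | tr ∈ A.trans ∧ tr.2.1 ∉ Tf}, A.lbl⟩

/-- local automaton: same data, re-labelled by a local observation map. -/
def localAut (A : FSA X T Λ) (O : T → Option Λ) : FSA X T Λ :=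
  ⟨A.init, A.trans, O⟩

end FSA

/-- local observation map of an observer with observable event set `To`:
it sees the global label on events of `To` and nothing otherwise. -/
noncomputable def localObs {T : Type*} {Λ : Type*} (ℓ : T → Option Λ) (To : Set T) :
    T → Option Λ :=
  fun t => @ite _ (t ∈ To) (Classical.propDecidable _) (ℓ t) none

/-- the first `n` events of an infinite event sequence. -/
def pre {T : Type*} (s : ℕ → T) (n : ℕ) : List T := (List.range n).map s

/-- `s ∈ T*T_f`: the word `s` ends with a faulty event. -/
def endsFaulty {T : Type*} (Tf : Set T) (s : List T) : Prop :=
  ∃ (s₁ : List T) (t : T), t ∈ Tf ∧ s = s₁ ++ [t]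

/-- `T_f ∈ s`: the word `s` contains a faulty event. -/
def hasFault {T : Type*} (Tf : Set T) (s : List T) : Prop := ∃ t ∈ s, t ∈ Tf

namespace FSA

variable {X : Type*} {T : Type*} {Λ : Type*} {L : ℕ}

/-- O-co-detectability (Definition CoDet). -/
def CoDetectable (A : FSA X T Λ) (O : Fin L → T → Option Λ) : Prop :=
  ∃ k : ℕ, ∀ s ∈ A.LangW, ∃ i : Fin L, ∀ n : ℕ,
    k ≤ (obsW (O i) (pre s n)).length →
    (A.est (O i) (obsW (O i) (pre s n))).ncard = 1

/-- strong detectability (Definition StrDet). -/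
def StronglyDetectable (A : FSA X T Λ) : Prop :=
  ∃ k : ℕ, ∀ s ∈ A.LangW, ∀ n : ℕ,
    k ≤ (obsW A.lbl (pre s n)).length →
    (A.est A.lbl (obsW A.lbl (pre s n))).ncard = 1

/-- (O, T_f)-co-diagnosability (Definition CoDiag). -/
def CoDiagnosable (A : FSA X T Λ) (O : Fin L → T → Option Λ) (Tf : Set T) : Prop :=
  ∃ k : ℕ, ∀ s s' : List T, s ∈ A.Lang → endsFaulty Tf s → s ++ s' ∈ A.Lang →
    k ≤ s'.length →
    ∃ i : Fin L, ∀ s'' ∈ A.Lang, obsW (O i) s'' = obsW (O i) (s ++ s') → hasFault Tf s''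

/-- T_f-diagnosability (Definition Diag). -/
def Diagnosable (A : FSA X T Λ) (Tf : Set T) : Prop :=
  ∃ k : ℕ, ∀ s s' : List T, s ∈ A.Lang → endsFaulty Tf s → s ++ s' ∈ A.Lang →
    k ≤ s'.length →
    ∀ s'' ∈ A.Lang, obsW A.lbl s'' = obsW A.lbl (s ++ s') → hasFault Tf s''

/-- (O, T_f)-co-predictability (Definition CoPred). -/
def CoPredictable (A : FSA X T Λ) (O : Fin L → T → Option Λ) (Tf : Set T) : Prop :=
  ∃ k : ℕ, ∀ s ∈ A.Lang, endsFaulty Tf s →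
    ∃ s' : List T, s' <+: s ∧ ¬ hasFault Tf s' ∧
      ∃ i : Fin L, ∀ u v : List T, u ++ v ∈ A.Lang → obsW (O i) s' = obsW (O i) u →
        ¬ hasFault Tf u → k ≤ v.length → hasFault Tf v

/-- T_f-predictability (Definition Pred). -/
def Predictable (A : FSA X T Λ) (Tf : Set T) : Prop :=
  ∃ k : ℕ, ∀ s ∈ A.Lang, endsFaulty Tf s →
    ∃ s' : List T, s' <+: s ∧ ¬ hasFault Tf s' ∧
      ∀ u v : List T, u ++ v ∈ A.Lang → obsW A.lbl s' = obsW A.lbl u →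
        ¬ hasFault Tf u → k ≤ v.length → hasFault Tf v

end FSA

section CC

variable {T : Type*} {Λ : Type*} {L : ℕ}

/-- labelling extended to `Option T` (with `none` = ε). -/
def obsE (ℓ : T → Option Λ) : Option T → Option Λ := fun t? => t?.bind ℓ

/-- one optional step: `none` = stay put, `some t` = take a `t`-transition. -/
def stepOpt {X : Type*} (tr : Set (X × T × X)) : X → Option T → X → Prop :=
  fun x t? y =>
    match t? with
    | none => x = y
    | some t => (x, t, y) ∈ tr

/-- validity of a composite event of the concurrent composition,
restricted to the "active" local components `act`. -/
def ccEventOn (ℓs : Fin L → T → Option Λ) (act : Fin L → Prop)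
    (t0 : Option T) (ts : Fin L → Option T) : Prop :=
  ((∀ j, act j → obsE (ℓs j) t0 = none) ∧
   (∀ j, act j → obsE (ℓs j) (ts j) = none) ∧
   ((t0 ≠ none ∧ ∀ j, act j → ts j = none) ∨
    (t0 = none ∧ ∃ j, act j ∧ ts j ≠ none ∧ ∀ j', act j' → j' ≠ j → ts j' = none)))
  ∨
  ((∃ j, act j ∧ obsE (ℓs j) t0 ≠ none) ∧
   (∀ l, act l →
     (obsE (ℓs l) t0 = none → ts l = none) ∧
     (obsE (ℓs l) t0 ≠ none → obsE (ℓs l) (ts l) = obsE (ℓs l) t0)))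

/-- validity of a composite event of the concurrent composition. -/
def ccEvent (ℓs : Fin L → T → Option Λ) (t0 : Option T) (ts : Fin L → Option T) : Prop :=
  ccEventOn ℓs (fun _ => True) t0 ts

/-- transition relation of the concurrent composition `CC_A(A0; A 0, …, A (L-1))`. -/
def ccTrans {X0 : Type*} {Xs : Fin L → Type*}
    (A0 : FSA X0 T Λ) (A : ∀ i, FSA (Xs i) T Λ) :
    (X0 × (∀ i, Xs i)) → (Option T × (Fin L → Option T)) → (X0 × (∀ i, Xs i)) → Prop :=
  fun p e q =>
    ccEvent (fun i => (A i).lbl) e.1 e.2 ∧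
    stepOpt A0.trans p.1 e.1 q.1 ∧
    ∀ i, stepOpt (A i).trans (p.2 i) (e.2 i) (q.2 i)

/-- initial states of the concurrent composition. -/
def ccInit {X0 : Type*} {Xs : Fin L → Type*}
    (A0 : FSA X0 T Λ) (A : ∀ i, FSA (Xs i) T Λ) : Set (X0 × (∀ i, Xs i)) :=
  {p | p.1 ∈ A0.init ∧ ∀ i, p.2 i ∈ (A i).init}

end CC

section Dia

/-- events of the ⋄-variant of the concurrent composition: ε, an event of `T`,
or the fresh event ⋄. -/
inductive DEv (T : Type*) where
  | eps : DEv T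
  | ev : T → DEv T
  | dia : DEv T

variable {X : Type*} {T : Type*} {Λ : Type*} {L : ℕ}

def devOf : Option T → DEv T
  | none => DEv.eps
  | some t => DEv.ev t

def devToOpt : DEv T → Option T
  | DEv.ev t => some t
  | _ => none

/-- transition relation of the variant concurrent composition
`CC_A^⋄(S; S_1, …, S_L)` of an FSA `A` with its local automata given by the
local observation maps `O i`.  A local component equal to `none` is the fresh
state ⋄. -/
def diaTrans (A : FSA X T Λ) (O : Fin L → T → Option Λ) :
    (X × (Fin L → Option X)) → (Option T × (Fin L → DEv T)) →
    (X × (Fin L → Option X)) → Prop :=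
  fun p e q =>
    -- an ordinary transition of the concurrent composition (all components in X)
    ((∃ ts : Fin L → Option T,
        (∀ i, e.2 i = devOf (ts i)) ∧
        ccEvent O e.1 ts ∧
        stepOpt A.trans p.1 e.1 q.1 ∧
        (∀ i, ∃ xi yi, p.2 i = some xi ∧ q.2 i = some yi ∧ stepOpt A.trans xi (ts i) yi)))
    ∨
    -- the extra ⋄-transitions, at states with some component differing from the 0-th
    ((∃ i, p.2 i ≠ some p.1) ∧
     (∀ i, p.2 i ≠ some p.1 → e.2 i = DEv.dia ∧ q.2 i = none) ∧
     (∃ ts : Fin L → Option T,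
        (∀ i, p.2 i = some p.1 → e.2 i = devOf (ts i)) ∧
        ((ccEventOn O (fun i => p.2 i = some p.1) e.1 ts ∧
          stepOpt A.trans p.1 e.1 q.1 ∧
          (∀ i, p.2 i = some p.1 → ∃ yi, q.2 i = some yi ∧ stepOpt A.trans p.1 (ts i) yi))
         ∨
         (e.1 = none ∧ q.1 = p.1 ∧
          (∀ i, p.2 i = some p.1 → ts i = none ∧ q.2 i = some p.1)))))

/-- initial states of the variant concurrent composition. -/
def diaInit (A : FSA X T Λ) : Set (X × (Fin L → Option X)) :=
  {p | p.1 ∈ A.init ∧ ∀ i, ∃ z ∈ A.init, p.2 i = some z}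

end Dia

/-- a (possibly partial) deterministic finite automaton. -/
structure PDFA (Q : Type*) (A : Type*) where
  start : Q
  accept : Set Q
  trans : Set (Q × A × Q)
  deterministic : ∀ q a q' q'', (q, a, q') ∈ trans → (q, a, q'') ∈ trans → q' = q''

namespace PDFA

variable {Q : Type*} {A : Type*}

def step (M : PDFA Q A) (q : Q) (a : A) (q' : Q) : Prop := (q, a, q') ∈ M.trans

def Accepts (M : PDFA Q A) (w : List A) : Prop :=
  ∃ q, RunRel M.step M.start w q ∧ q ∈ M.accept

def Acyclic (M : PDFA Q A) : Prop := ¬ ∃ (q : Q) (w : List A), w ≠ [] ∧ RunRel M.step q w q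

def Complete (M : PDFA Q A) : Prop := ∀ q a, ∃ q', (q, a, q') ∈ M.trans

def Deadlock (M : PDFA Q A) (q : Q) : Prop := ∀ a q', (q, a, q') ∉ M.trans

def DeadlockFree (M : PDFA Q A) : Prop := ∀ q, ∃ a q', (q, a, q') ∈ M.trans

end PDFA

end DES
namespace DES
section helpers

variable {S E X T Λ : Type*} {L : ℕ}

theorem RunRel.append {δ : S → E → S → Prop} {x y z : S} {a b : List E}
    (h : RunRel δ x a y) (h' : RunRel δ y b z) : RunRel δ x (a ++ b) z := by
  induction h with
  | nil x => exact h'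
  | cons s _ ih => exact RunRel.cons s (ih h')

theorem RunRel.split {δ : S → E → S → Prop} {a b : List E} {x z : S}
    (h : RunRel δ x (a ++ b) z) : ∃ y, RunRel δ x a y ∧ RunRel δ y b z := by
  induction a generalizing x with
  | nil => exact ⟨x, RunRel.nil x, h⟩
  | cons e a ih =>
    cases h with
    | cons s r =>
      obtain ⟨y, h1, h2⟩ := ih r
      exact ⟨y, RunRel.cons s h1, h2⟩

theorem RunRel.states {δ : S → E → S → Prop} {x z : S} {w : List E}
    (h : RunRel δ x w z) :
    ∃ f : ℕ → S, f 0 = x ∧ ∀ n < w.length, ∃ e, δ (f n) e (f (n+1)) := by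
  induction h with
  | nil x => exact ⟨fun _ => x, rfl, by simp⟩
  | @cons x y z e w s r ih =>
    obtain ⟨f, h0, hf⟩ := ih
    refine ⟨fun n => Nat.casesOn n x f, rfl, ?_⟩
    intro n hn
    cases n with
    | zero => exact ⟨e, by simpa [h0] using s⟩
    | succ n => exact hf n (by simpa using hn)

theorem run_of_states {δ : S → E → S → Prop} {f : ℕ → S} {N : ℕ}
    (hf : ∀ n < N, ∃ e, δ (f n) e (f (n+1))) (m d : ℕ) (h : m + d ≤ N) :
    ∃ w : List E, w.length = d ∧ RunRel δ (f m) w (f (m + d)) := by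
  induction d with
  | zero => exact ⟨[], rfl, RunRel.nil _⟩
  | succ d ih =>
    obtain ⟨w, hw, hr⟩ := ih (by omega)
    obtain ⟨e, he⟩ := hf (m + d) (by omega)
    exact ⟨w ++ [e], by simp [hw], hr.append (RunRel.cons he (RunRel.nil _))⟩

theorem RunRel.exists_cycle [Fintype S] {δ : S → E → S → Prop} {x z : S} {w : List E}
    (h : RunRel δ x w z) (hc : Fintype.card S ≤ w.length) :
    ∃ (y : S) (a b : List E), RunRel δ x a y ∧ b ≠ [] ∧ RunRel δ y b y := by
  obtain ⟨f, h0, hf⟩ := h.states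
  obtain ⟨i, j, hij, he⟩ := Fintype.exists_ne_map_eq_of_card_lt
    (fun i : Fin (w.length + 1) => f i) (by simpa using Nat.lt_succ_of_le hc)
  wlog hlt : i < j generalizing i j
  · exact this j i hij.symm he.symm (lt_of_le_of_ne (not_lt.mp hlt) hij.symm)
  have hlt' : (i : ℕ) < j := hlt
  obtain ⟨a, -, ha⟩ := run_of_states hf 0 i (by omega)
  obtain ⟨b, hb, hb'⟩ := run_of_states hf i (j - i) (by omega)
  have e1 : (i : ℕ) + (j - i) = j := by omega
  rw [e1] at hb'
  rw [← he] at hb'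
  rw [h0, Nat.zero_add] at ha
  refine ⟨f i, a, b, ha, ?_, hb'⟩
  rintro rfl
  simp at hb
  omega

theorem RunRel.pump {δ : S → E → S → Prop} {y : S} {b : List E} (hb : b ≠ [])
    (h : RunRel δ y b y) (k : ℕ) : ∃ w, k ≤ w.length ∧ RunRel δ y w y := by
  induction k with
  | zero => exact ⟨[], by simp, RunRel.nil _⟩
  | succ k ih =>
    obtain ⟨w, hw, hr⟩ := ih
    refine ⟨b ++ w, ?_, h.append hr⟩
    have := List.length_pos_iff.mpr hb
    simp; omega

theorem run_normal_iff (A : FSA X T Λ) (Tf : Set T) {x y : X} {w : List T} :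
    RunRel (A.normal Tf).step x w y ↔ RunRel A.step x w y ∧ ¬ hasFault Tf w := by
  constructor
  · intro h
    induction h with
    | nil x => exact ⟨RunRel.nil x, by simp [hasFault]⟩
    | cons s r ih =>
      refine ⟨RunRel.cons s.1 ih.1, ?_⟩
      rintro ⟨t, ht, htf⟩
      rcases List.mem_cons.mp ht with rfl | ht
      · exact s.2 htf
      · exact ih.2 ⟨t, ht, htf⟩
  · rintro ⟨h, hn⟩
    induction h with
    | nil x => exact RunRel.nil x
    | @cons x y z e w s r ih =>
      refine RunRel.cons ⟨s, fun he => hn ⟨e, by simp, he⟩⟩ (ih ?_)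
      rintro ⟨t, ht, htf⟩
      exact hn ⟨t, by simp [ht], htf⟩

theorem hasFault_append {Tf : Set T} {a b : List T} :
    hasFault Tf (a ++ b) ↔ hasFault Tf a ∨ hasFault Tf b := by
  simp only [hasFault, List.mem_append]
  constructor
  · rintro ⟨t, h | h, h'⟩
    · exact Or.inl ⟨t, h, h'⟩
    · exact Or.inr ⟨t, h, h'⟩
  · rintro (⟨t, h, h'⟩ | ⟨t, h, h'⟩)
    · exact ⟨t, Or.inl h, h'⟩
    · exact ⟨t, Or.inr h, h'⟩

theorem first_fault {Tf : Set T} {w : List T} (h : hasFault Tf w) :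
    ∃ a t b, w = a ++ t :: b ∧ t ∈ Tf ∧ ¬ hasFault Tf a := by
  induction w with
  | nil => simp [hasFault] at h
  | cons e w ih =>
    by_cases he : e ∈ Tf
    · exact ⟨[], e, w, rfl, he, by simp [hasFault]⟩
    · have hw : hasFault Tf w := by
        obtain ⟨t, ht, htf⟩ := h
        rcases List.mem_cons.mp ht with rfl | ht
        · exact absurd htf he
        · exact ⟨t, ht, htf⟩
      obtain ⟨a, t, b, rfl, ht, ha⟩ := ih hw
      refine ⟨e :: a, t, b, rfl, ht, ?_⟩
      rintro ⟨t', ht', htf⟩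
      rcases List.mem_cons.mp ht' with rfl | ht'
      · exact he htf
      · exact ha ⟨t', ht', htf⟩

/-- split a word along a decomposition of its observation -/
theorem obsW_split {O : T → Option Λ} (p q : List Λ) (u : List T) (h : obsW O u = p ++ q) :
    ∃ u1 u2, u = u1 ++ u2 ∧ obsW O u1 = p ∧ obsW O u2 = q := by
  obtain ⟨a, b, h1, h2, h3⟩ := List.filterMap_eq_append_iff.mp h
  exact ⟨a, b, h1, h2, h3⟩

theorem obsW_cons_split {O : T → Option Λ} (l : Λ) (q : List Λ) (u : List T)
    (h : obsW O u = l :: q) :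
    ∃ u1 t u2, u = u1 ++ t :: u2 ∧ obsW O u1 = [] ∧ O t = some l ∧ obsW O u2 = q := by
  obtain ⟨a, t, b, h1, h2, h3, h4⟩ := List.filterMap_eq_cons_iff.mp h
  exact ⟨a, t, b, h1, List.filterMap_eq_nil_iff.mpr h2, h3, h4⟩

theorem obsW_append {O : T → Option Λ} (a b : List T) :
    obsW O (a ++ b) = obsW O a ++ obsW O b := List.filterMap_append

theorem stepOpt_run {A : FSA X T Λ} {x y : X} {t : Option T} (h : stepOpt A.trans x t y) :
    RunRel A.step x t.toList y := by
  cases t with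
  | none => cases h; exact RunRel.nil _
  | some t => exact RunRel.cons h (RunRel.nil _)

theorem obsW_toList (O : T → Option Λ) (t : Option T) : obsW O t.toList = (obsE O t).toList := by
  cases t with
  | none => rfl
  | some t =>
    simp only [obsW, obsE, Option.toList_some, Option.bind_some]
    cases h : O t <;> simp [h]

theorem ccEvent_obs {O : Fin L → T → Option Λ} {t0 : Option T} {ts : Fin L → Option T}
    (h : ccEvent O t0 ts) (i : Fin L) : obsE (O i) (ts i) = obsE (O i) t0 := by
  rcases h with ⟨h1, h2, -⟩ | ⟨-, h⟩
  · rw [h1 i trivial, h2 i trivial]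
  · by_cases hn : obsE (O i) t0 = none
    · rw [(h i trivial).1 hn, hn]; rfl
    · exact (h i trivial).2 hn

/-- projections of a run of the concurrent composition -/
theorem cc_project {A0 : FSA X T Λ} {A : Fin L → FSA X T Λ}
    {p q : X × (Fin L → X)} {s : List (Option T × (Fin L → Option T))}
    (h : RunRel (ccTrans A0 A) p s q) :
    ∃ (w : List T) (u : Fin L → List T), RunRel A0.step p.1 w q.1 ∧
      ∀ i, RunRel (A i).step (p.2 i) (u i) (q.2 i) ∧ obsW (A i).lbl (u i) = obsW (A i).lbl w := by
  induction h with
  | nil x => exact ⟨[], fun _ => [], RunRel.nil _, fun i => ⟨RunRel.nil _, rfl⟩⟩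
  | @cons x y z e s hs hr ih =>
    obtain ⟨w, u, hw, hu⟩ := ih
    obtain ⟨h1, h2, h3⟩ := hs
    refine ⟨e.1.toList ++ w, fun i => (e.2 i).toList ++ u i, (stepOpt_run h2).append hw, ?_⟩
    intro i
    refine ⟨(stepOpt_run (h3 i)).append (hu i).1, ?_⟩
    rw [obsW_append, obsW_append, obsW_toList, obsW_toList, (hu i).2]
    have := ccEvent_obs h1 i
    simp only at this
    rw [this]

def CCR (A0 : FSA X T Λ) (A : Fin L → FSA X T Λ) (p q : X × (Fin L → X)) : Prop :=
  ∃ s, RunRel (ccTrans A0 A) p s q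

theorem CCR.trans {A0 : FSA X T Λ} {A : Fin L → FSA X T Λ} {p q r : X × (Fin L → X)}
    (h : CCR A0 A p q) (h' : CCR A0 A q r) : CCR A0 A p r := by
  obtain ⟨s, hs⟩ := h
  obtain ⟨s', hs'⟩ := h'
  exact ⟨s ++ s', hs.append hs'⟩

theorem CCR.single {A0 : FSA X T Λ} {A : Fin L → FSA X T Λ} {p q : X × (Fin L → X)}
    (e : Option T × (Fin L → Option T)) (h : ccTrans A0 A p e q) : CCR A0 A p q :=
  ⟨[e], RunRel.cons h (RunRel.nil _)⟩

theorem CCR.refl {A0 : FSA X T Λ} {A : Fin L → FSA X T Λ} (p : X × (Fin L → X)) :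
    CCR A0 A p p := ⟨[], RunRel.nil _⟩

/-- one local component runs along an unobservable word -/
theorem cc_silent_one (A0 : FSA X T Λ) (A : Fin L → FSA X T Λ) (x0 : X) (i : Fin L)
    {a y : X} {w : List T} (h : RunRel (A i).step a w y) (hw : obsW (A i).lbl w = [])
    (x : Fin L → X) (hx : x i = a) : CCR A0 A (x0, x) (x0, Function.update x i y) := by
  induction h generalizing x with
  | nil a => subst hx; rw [Function.update_eq_self]; exact CCR.refl _
  | @cons a b c t w hs hr ih =>
    have hw' := List.filterMap_eq_nil_iff.mp hw
    have ht : (A i).lbl t = none := hw' t (by simp)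
    have := ih (List.filterMap_eq_nil_iff.mpr fun t' h' => hw' t' (by simp [h']))
      (Function.update x i b) (by simp)
    rw [Function.update_idem] at this
    refine CCR.trans (CCR.single (none, Function.update (fun _ => none) i (some t)) ?_) this
    refine ⟨Or.inl ⟨fun _ _ => rfl, ?_, Or.inr ⟨rfl, i, trivial, by simp, ?_⟩⟩, rfl, ?_⟩
    · intro j _
      by_cases hj : j = i
      · subst hj; simp [obsE, ht]
      · simp [obsE, hj]
    · intro j _ hj; simp [hj]
    · intro j
      by_cases hj : j = i
      · subst hj; simp only [Function.update_self]; rw [hx]; exact hs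
      · simp [hj, stepOpt]

/-- all local components run along unobservable words -/
theorem cc_silent (A0 : FSA X T Λ) (A : Fin L → FSA X T Λ) (x0 : X)
    (x y : Fin L → X) (w : Fin L → List T) (h : ∀ i, RunRel (A i).step (x i) (w i) (y i))
    (hw : ∀ i, obsW (A i).lbl (w i) = []) : CCR A0 A (x0, x) (x0, y) := by
  have key : ∀ F : Finset (Fin L), CCR A0 A (x0, x) (x0, fun i => if i ∈ F then y i else x i) := by
    intro F
    induction F using Finset.induction_on with
    | empty => simpa using CCR.refl _
    | @insert j F hj ih =>
      refine ih.trans ?_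
      have := cc_silent_one A0 A x0 j (h j) (hw j) (fun i => if i ∈ F then y i else x i) (by simp [hj])
      convert this using 2
      funext i
      by_cases hi : i = j
      · subst hi; simp
      · simp [hi]
  simpa using key Finset.univ

theorem cc_build (A0 : FSA X T Λ) (A : Fin L → FSA X T Λ) {x0 y0 : X} {s : List T}
    (h0 : RunRel A0.step x0 s y0)
    (x y : Fin L → X) (u : Fin L → List T) (h : ∀ i, RunRel (A i).step (x i) (u i) (y i))
    (hu : ∀ i, obsW (A i).lbl (u i) = obsW (A i).lbl s) : CCR A0 A (x0, x) (y0, y) := by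
  induction h0 generalizing x u with
  | nil x0 => exact cc_silent A0 A x0 x y u h hu
  | @cons x0 z0 y0 t s hs hr ih =>
    have key : ∀ i, ∃ (w : List T) (m : X) (o : Option T) (m' : X) (r : List T),
        RunRel (A i).step (x i) w m ∧ obsW (A i).lbl w = [] ∧ stepOpt (A i).trans m o m' ∧
        RunRel (A i).step m' r (y i) ∧ obsW (A i).lbl r = obsW (A i).lbl s ∧
        ((A i).lbl t = none → o = none) ∧ obsE (A i).lbl o = (A i).lbl t := by
      intro i
      have hi := hu i
      cases hl : (A i).lbl t with
      | none =>
        refine ⟨[], x i, none, x i, u i, RunRel.nil _, rfl, rfl, h i, ?_, fun _ => rfl, rfl⟩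
        rw [hi]; simp [obsW, hl]
      | some l =>
        have e : obsW (A i).lbl (u i) = l :: obsW (A i).lbl s := by
          rw [hi]; simp [obsW, hl]
        obtain ⟨u1, t', u2, he, h1, h2, h3⟩ := obsW_cons_split _ _ _ e
        have hrun := h i
        rw [he] at hrun
        obtain ⟨m, hm, hm'⟩ := hrun.split
        cases hm' with
        | @cons _ m' _ _ _ hst hrr =>
          exact ⟨u1, m, some t', m', u2, hm, h1, hst, hrr, h3, by simp, by simpa [obsE] using h2⟩
    choose w m o m' r k1 k2 k3 k4 k5 k6 k7 using key
    refine (cc_silent A0 A x0 x m w k1 k2).trans ?_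
    refine CCR.trans (q := (z0, m')) (CCR.single (some t, o) ⟨?_, hs, k3⟩) (ih m' r k4 k5)
    by_cases hall : ∀ i, (A i).lbl t = none
    · refine Or.inl ⟨fun j _ => hall j, fun j _ => ?_, Or.inl ⟨by simp, fun j _ => k6 j (hall j)⟩⟩
      rw [k7 j, hall j]
    · obtain ⟨j, hj⟩ := not_forall.mp hall
      exact Or.inr ⟨⟨j, trivial, hj⟩, fun l _ => ⟨fun e => k6 l e, fun _ => k7 l⟩⟩

end helpers
end DES

open DES in
/-- Theorem (co-predictability criterion): an FSA is not (O, T_f)-co-predictable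
iff the concurrent composition `CC_A(S^n; S_1^n, …, S_L^n)` contains a
transition sequence `x_0' →^{s_1'} x_1'` from an initial state such that
`(x_1'(0), t_f, x) ∈ δ` for some faulty `t_f`, and for each location `i` the
normal sub-local automaton `S_i^n` has a transition cycle reachable from
`x_1'(i)`. -/
theorem not_coPredictable_iff_cc_witness
    {X : Type*} {T : Type*} {Λ : Type*} [Fintype X] [Fintype T] {L : ℕ}
    (A : FSA X T Λ) (Ti : Fin L → Set T) (Tf : Set T) :
    ¬ A.CoPredictable (fun i => localObs A.lbl (Ti i)) Tf ↔
    ∃ (x0' x1' : X × (Fin L → X)) (s1 : List (Option T × (Fin L → Option T))),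
      x0' ∈ ccInit (A.normal Tf)
        (fun i => (A.localAut (localObs A.lbl (Ti i))).normal Tf) ∧
      RunRel (ccTrans (A.normal Tf)
        (fun i => (A.localAut (localObs A.lbl (Ti i))).normal Tf)) x0' s1 x1' ∧
      (∃ tf ∈ Tf, ∃ x : X, (x1'.1, tf, x) ∈ A.trans) ∧
      (∀ i : Fin L, ∃ y : X,
        (y = x1'.2 i ∨ ((A.localAut (localObs A.lbl (Ti i))).normal Tf).Reach (x1'.2 i) y) ∧
        ((A.localAut (localObs A.lbl (Ti i))).normal Tf).OnCycle y) := by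
  set O : Fin L → T → Option Λ := fun i => localObs A.lbl (Ti i) with hO
  constructor
  · intro hnot
    unfold FSA.CoPredictable at hnot
    push Not at hnot
    obtain ⟨s, ⟨z, hz, z', hrun⟩, ⟨s₁, tf, htf, rfl⟩, hs⟩ := hnot (Fintype.card X)
    obtain ⟨a, t, b, hab, ht, ha⟩ := first_fault (Tf := Tf) (w := s₁ ++ [tf]) ⟨tf, by simp, htf⟩
    rw [hab] at hrun hs
    obtain ⟨x1, hr1, hr2⟩ := RunRel.split hrun
    have hs' := hs a (List.prefix_append _ _) ha
    choose u v huv hobs hnu hlen hnv using hs'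
    have key : ∀ i, ∃ c ∈ A.init, ∃ d e, RunRel A.step c (u i) d ∧ RunRel A.step d (v i) e := by
      intro i
      obtain ⟨c, hc, e, hce⟩ := huv i
      obtain ⟨d, h1, h2⟩ := RunRel.split hce
      exact ⟨c, hc, d, e, h1, h2⟩
    choose c hc d e h1 h2 using key
    obtain ⟨S, hS⟩ := cc_build (A.normal Tf) (fun i => (A.localAut (O i)).normal Tf)
      ((run_normal_iff A Tf).mpr ⟨hr1, ha⟩) c d u
      (fun i => (run_normal_iff A Tf).mpr ⟨h1 i, hnu i⟩) (fun i => (hobs i).symm)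
    refine ⟨(z, c), (x1, d), S, ⟨hz, hc⟩, hS, ?_, ?_⟩
    · cases hr2 with
      | cons hst _ => exact ⟨t, ht, _, hst⟩
    · intro i
      obtain ⟨y, p, q, hp, hq, hq'⟩ :=
        ((run_normal_iff A Tf).mpr ⟨h2 i, hnv i⟩).exists_cycle (hlen i)
      refine ⟨y, ?_, q, hq, hq'⟩
      cases hp with
      | nil => exact Or.inl rfl
      | cons g1 g2 => exact Or.inr ⟨_, by simp, RunRel.cons g1 g2⟩
  · rintro ⟨x0', x1', S, ⟨hi0, hi⟩, hS, ⟨tf, htf, x, hx⟩, hcyc⟩ ⟨k, hk⟩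
    obtain ⟨w, u, hw, hu⟩ := cc_project hS
    obtain ⟨hwA, hwn⟩ := (run_normal_iff A Tf).mp hw
    obtain ⟨s', hpre, hn, i, H⟩ := hk (w ++ [tf])
      ⟨_, hi0, x, hwA.append (RunRel.cons hx (RunRel.nil _))⟩ ⟨w, tf, htf, rfl⟩
    have hsw : s' <+: w := by
      rcases List.prefix_concat_iff.mp hpre with h | h
      · subst h
        exact absurd ⟨tf, by simp, htf⟩ hn
      · exact h
    obtain ⟨r, rfl⟩ := hsw
    obtain ⟨hui, huo⟩ := hu i
    rw [obsW_append] at huo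
    obtain ⟨u1, u2, hue, ho1, ho2⟩ := obsW_split _ _ _ huo
    obtain ⟨y, hy, q, hq, hq'⟩ := hcyc i
    obtain ⟨p, hp⟩ : ∃ p, RunRel (A.normal Tf).step (x1'.2 i) p y := by
      rcases hy with rfl | ⟨p, -, hp⟩
      · exact ⟨[], RunRel.nil _⟩
      · exact ⟨p, hp⟩
    obtain ⟨c, hc, hcr⟩ := RunRel.pump (δ := (A.normal Tf).step) hq hq' k
    have hui' : RunRel (A.normal Tf).step (x0'.2 i) (u i) (x1'.2 i) := hui
    have hall := hui'.append (hp.append hcr)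
    rw [hue, List.append_assoc] at hall
    obtain ⟨hA, hnf⟩ := (run_normal_iff A Tf).mp hall
    rw [hasFault_append, not_or] at hnf
    exact hnf.2 (H u1 (u2 ++ (p ++ c)) ⟨_, hi i, _, hA⟩ ho1.symm hnf.1 (by simp; omega))
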